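/- arXiv:2412.11822 — 2 statements merged into one kernel-verified Lean document; each statement's English description precedes it below -/
import Mathlib

section
/- Let 1 ≤ k ≤ n and α > 0. The function λ ↦ (σ_k(λ) + α σ_{k−1}(λ))^{1/k} is concave on the convex cone Γ̃_k. -/
open scoped BigOperators

noncomputable section

/-- The `j`-th elementary symmetric function of the entries of `lam` indexed by `T`
(`j : ℤ`, with value `0` for `j < 0`). -/
def sigmaOn {n : ℕ} (T : Finset (Fin n)) (j : ℤ) (lam : Fin n → ℝ) : ℝ :=
  if 0 ≤ j then ∑ s ∈ T.powersetCard j.toNat, ∏ i ∈ s, lam i else 0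

/-- The `j`-th elementary symmetric polynomial `σ_j(λ)`. -/
def esymmR {n : ℕ} (j : ℤ) (lam : Fin n → ℝ) : ℝ := sigmaOn Finset.univ j lam

/-- The Garding cone `Γ_k`. -/
def GammaCone (n k : ℕ) : Set (Fin n → ℝ) :=
  {lam | ∀ i : ℕ, 1 ≤ i → i ≤ k → 0 < esymmR (i : ℤ) lam}

/-- `S_j(λ) = σ_j(λ) + α σ_{j-1}(λ)`. -/
def Sfun {n : ℕ} (α : ℝ) (j : ℤ) (lam : Fin n → ℝ) : ℝ :=
  esymmR j lam + α * esymmR (j - 1) lam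

/-- The cone `Γ̃_k = Γ_{k-1} ∩ {λ : S_k(λ) > 0}`. -/
def GammaTilde (n k : ℕ) (α : ℝ) : Set (Fin n → ℝ) :=
  GammaCone n (k - 1) ∩ {lam | 0 < Sfun α (k : ℤ) lam}

/-- `S_k^{pp}(λ) = σ_{k-1}(λ|p) + α σ_{k-2}(λ|p)`, where `(λ|p)` deletes the
`p`-th entry of `λ`. -/
def SD {n : ℕ} (α : ℝ) (k : ℤ) (lam : Fin n → ℝ) (p : Fin n) : ℝ :=
  sigmaOn (Finset.univ.erase p) (k - 1) lam + α * sigmaOn (Finset.univ.erase p) (k - 2) lam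

/-- `S_k^{pp,qq}(λ) = σ_{k-2}(λ|pq) + α σ_{k-3}(λ|pq)` for `p ≠ q`, where `(λ|pq)`
deletes the `p`-th and `q`-th entries of `λ`. -/
def SDD {n : ℕ} (α : ℝ) (k : ℤ) (lam : Fin n → ℝ) (p q : Fin n) : ℝ :=
  sigmaOn ((Finset.univ.erase p).erase q) (k - 2) lam
    + α * sigmaOn ((Finset.univ.erase p).erase q) (k - 3) lam

open Polynomial in
theorem aux_laguerre (f : ℝ[X]) (hf : f.Splits) (x : ℝ) :
    0 ≤ (f.derivative.eval x) ^ 2 - f.eval x * f.derivative.derivative.eval x := by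
  unfold Polynomial.Splits at hf
  induction hf using Submonoid.closure_induction with
  | mem y hy =>
    rcases hy with ⟨a, rfl⟩ | ⟨a, rfl⟩ <;> simp
  | one => simp
  | mul f g _ _ hf hg =>
    simp only [derivative_mul, derivative_add, eval_add, eval_mul]
    nlinarith [mul_nonneg (sq_nonneg (g.eval x)) hf, mul_nonneg (sq_nonneg (f.eval x)) hg]

open Polynomial in
theorem aux_splits_derivative (f : ℝ[X]) (hf : f.Splits) : f.derivative.Splits := by
  rw [splits_iff_card_roots] at hf ⊢
  by_cases h0 : f.natDegree = 0
  · rw [derivative_of_natDegree_zero h0]; simp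
  have h1 := card_roots_le_derivative f
  have h2 := card_roots' f.derivative
  have h3 := natDegree_derivative_lt h0
  omega

open Polynomial in
theorem aux_newton_poly (f : ℝ[X]) (hf : f.Splits) (m : ℕ) :
    f.coeff m * f.coeff (m + 2) ≤ f.coeff (m + 1) ^ 2 := by
  have hs : ∀ m : ℕ, (derivative^[m] f).Splits := by
    intro m
    induction m with
    | zero => simpa
    | succ m ih => rw [Function.iterate_succ_apply']; exact aux_splits_derivative _ ih
  have h := aux_laguerre _ (hs m) 0
  rw [← Function.iterate_succ_apply' derivative, ← Function.iterate_succ_apply' derivative] at h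
  simp only [← coeff_zero_eq_eval_zero, coeff_iterate_derivative, zero_add,
    Nat.descFactorial_self, nsmul_eq_mul, Nat.factorial_succ, Nat.succ_eq_add_one] at h
  push_cast at h
  have hm : (0 : ℝ) < (m.factorial : ℝ) := by exact_mod_cast m.factorial_pos
  have h2 : 0 ≤ (m.factorial : ℝ) ^ 2 * (m + 1) * ((m + 1) * f.coeff (m + 1) ^ 2
      - (m + 2) * (f.coeff m * f.coeff (m + 2))) := by
    refine h.trans_eq ?_
    ring_nf
  have h3 := nonneg_of_mul_nonneg_right h2 (by positivity)
  have hm' : (0 : ℝ) ≤ m := by positivity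
  by_contra hc
  push Not at hc
  nlinarith [sq_nonneg (f.coeff (m + 1)), mul_le_mul_of_nonneg_left hc.le hm']

/-- Elementary symmetric function on a finset. -/
def auxE {ι : Type*} (T : Finset ι) (j : ℕ) (x : ι → ℝ) : ℝ :=
  ∑ s ∈ T.powersetCard j, ∏ i ∈ s, x i

theorem auxE_zero {ι : Type*} (T : Finset ι) (x : ι → ℝ) : auxE T 0 x = 1 := by
  simp [auxE]

theorem auxE_insert {ι : Type*} [DecidableEq ι] {T : Finset ι} {a : ι} (ha : a ∉ T) (j : ℕ)
    (x : ι → ℝ) : auxE (insert a T) (j + 1) x = auxE T (j + 1) x + x a * auxE T j x := by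
  unfold auxE
  rw [Finset.powersetCard_succ_insert ha, Finset.sum_union, Finset.sum_image, Finset.mul_sum]
  · congr 1
    refine Finset.sum_congr rfl fun s hs => ?_
    rw [Finset.prod_insert]
    exact fun h => ha ((Finset.mem_powersetCard.1 hs).1 h)
  · intro s hs t ht hst
    have hs' : a ∉ s := fun h => ha ((Finset.mem_powersetCard.1 hs).1 h)
    have ht' : a ∉ t := fun h => ha ((Finset.mem_powersetCard.1 ht).1 h)
    rw [← Finset.erase_insert hs', hst, Finset.erase_insert ht']
  · rw [Finset.disjoint_left]
    intro s hs hs2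
    obtain ⟨t, _, rfl⟩ := Finset.mem_image.1 hs2
    exact ha ((Finset.mem_powersetCard.1 hs).1 (Finset.mem_insert_self _ _))

theorem auxE_erase {ι : Type*} [DecidableEq ι] {T : Finset ι} {a : ι} (ha : a ∈ T) (j : ℕ)
    (x : ι → ℝ) :
    auxE T (j + 1) x = auxE (T.erase a) (j + 1) x + x a * auxE (T.erase a) j x := by
  rw [← auxE_insert (Finset.notMem_erase a T), Finset.insert_erase ha]

theorem auxE_empty {ι : Type*} (j : ℕ) (x : ι → ℝ) : auxE (∅ : Finset ι) (j + 1) x = 0 := by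
  unfold auxE
  rw [Finset.powersetCard_eq_empty.2 (by simp), Finset.sum_empty]

theorem auxE_euler {ι : Type*} [DecidableEq ι] (T : Finset ι) (x : ι → ℝ) (j : ℕ) :
    ((j : ℝ) + 1) * auxE T (j + 1) x = ∑ i ∈ T, x i * auxE (T.erase i) j x := by
  induction T using Finset.induction_on generalizing j with
  | empty => simp [auxE_empty]
  | insert a T ha ih =>
    rw [Finset.sum_insert ha, Finset.erase_insert ha, auxE_insert ha]
    have he : ∀ i ∈ T, (insert a T).erase i = insert a (T.erase i) := by
      intro i hi
      rw [Finset.erase_insert_of_ne]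
      rintro rfl; exact ha hi
    have hn : ∀ i, a ∉ T.erase i := fun i h => ha (Finset.mem_of_mem_erase h)
    cases j with
    | zero =>
      have := ih 0
      simp only [auxE_zero] at this ⊢
      push_cast at this ⊢
      linarith
    | succ j =>
      have h1 := ih (j + 1)
      have h2 := ih j
      have h3 : ∑ i ∈ T, x i * auxE ((insert a T).erase i) (j + 1) x
          = ∑ i ∈ T, x i * auxE (T.erase i) (j + 1) x
            + x a * ∑ i ∈ T, x i * auxE (T.erase i) j x := by
        rw [Finset.mul_sum, ← Finset.sum_add_distrib]
        refine Finset.sum_congr rfl fun i hi => ?_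
        rw [he i hi, auxE_insert (hn i)]
        ring
      rw [h3, ← h1, ← h2]
      push_cast
      ring

open Polynomial in
theorem auxE_coeff {ι : Type*} [DecidableEq ι] (T : Finset ι) (x : ι → ℝ) (j : ℕ) :
    (∏ i ∈ T, (C (x i) * X + C 1)).coeff j = auxE T j x := by
  induction T using Finset.induction_on generalizing j with
  | empty =>
    cases j with
    | zero => simp [auxE_zero]
    | succ j => simp [auxE_empty, coeff_one]
  | insert a T ha ih =>
    rw [Finset.prod_insert ha, add_mul, mul_assoc]
    cases j with
    | zero => simp [auxE_zero, coeff_zero_eq_eval_zero, eval_prod]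
    | succ j =>
      rw [auxE_insert ha, coeff_add, coeff_C_mul, coeff_X_mul, coeff_C_mul, ih, ih]
      ring

open Polynomial in
theorem auxE_newton {ι : Type*} [DecidableEq ι] (T : Finset ι) (x : ι → ℝ) (m : ℕ) :
    auxE T m x * auxE T (m + 2) x ≤ auxE T (m + 1) x ^ 2 := by
  simp only [← auxE_coeff]
  apply aux_newton_poly
  refine Splits.prod fun i _ => ?_
  exact Splits.of_natDegree_le_one natDegree_linear_le

/-- Garding cone. -/
def auxG {ι : Type*} (T : Finset ι) (m : ℕ) (x : ι → ℝ) : Prop :=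
  ∀ j ≤ m, 0 < auxE T j x

theorem auxG_erase {ι : Type*} [DecidableEq ι] {T : Finset ι} {a : ι} (ha : a ∈ T) (m : ℕ)
    (x : ι → ℝ) (h : auxG T (m + 1) x) : auxG (T.erase a) m x := by
  intro j hj
  induction j with
  | zero => rw [auxE_zero]; exact one_pos
  | succ j ih =>
    have hB := ih (by omega)
    have h1 := h (j + 1) (by omega)
    have h2 := h (j + 1 + 1) (by omega)
    rw [auxE_erase ha] at h1 h2
    have hN := auxE_newton (T.erase a) x j
    by_contra hc
    push Not at hc
    nlinarith [mul_pos hB h2, mul_nonneg (neg_nonneg.2 hc) h1.le]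

theorem aux_term {x y Ax Bx Ay By Az Bz : ℝ} (hBx : 0 < Bx) (hBy : 0 < By) (hBz : 0 < Bz)
    (hx : 0 < Ax + x * Bx) (hy : 0 < Ay + y * By) (hz : 0 < Az + (x + y) * Bz)
    (h : Ax / Bx + Ay / By ≤ Az / Bz) :
    x * Ax / (Ax + x * Bx) + y * Ay / (Ay + y * By)
      ≤ (x + y) * Az / (Az + (x + y) * Bz) := by
  have key : ∀ x A B : ℝ, 0 < B → 0 < A + x * B →
      0 < x + A / B ∧ x * A / (A + x * B) = x - x ^ 2 / (x + A / B) := by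
    intro x A B hB hD
    have e : x + A / B = (A + x * B) / B := by field_simp; ring
    refine ⟨by rw [e]; positivity, ?_⟩
    rw [e]
    have := hD.ne'
    field_simp
    ring
  obtain ⟨px, ex⟩ := key x Ax Bx hBx hx
  obtain ⟨py, ey⟩ := key y Ay By hBy hy
  obtain ⟨pz, ez⟩ := key (x + y) Az Bz hBz hz
  rw [ex, ey, ez]
  have h1 : (x + y) ^ 2 / (x + y + Az / Bz) ≤ (x + y) ^ 2 / ((x + Ax / Bx) + (y + Ay / By)) := by
    apply div_le_div_of_nonneg_left (sq_nonneg _) (by positivity) (by linarith)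
  have h2 : (x + y) ^ 2 / ((x + Ax / Bx) + (y + Ay / By))
      ≤ x ^ 2 / (x + Ax / Bx) + y ^ 2 / (y + Ay / By) := by
    generalize x + Ax / Bx = s at *
    generalize y + Ay / By = t at *
    rw [div_add_div _ _ px.ne' py.ne', div_le_div_iff₀ (by positivity) (by positivity)]
    nlinarith [sq_nonneg (x * t - y * s)]
  linarith

theorem aux_main {ι : Type*} [DecidableEq ι] (m : ℕ) : ∀ (T : Finset ι) (x y : ι → ℝ),
    auxG T m x → auxG T m y → auxG T m (x + y) ∧
      auxE T (m + 1) x / auxE T m x + auxE T (m + 1) y / auxE T m y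
        ≤ auxE T (m + 1) (x + y) / auxE T m (x + y) := by
  induction m with
  | zero =>
    intro T x y _ _
    refine ⟨?_, ?_⟩
    · intro j hj
      obtain rfl : j = 0 := by omega
      rw [auxE_zero]; exact one_pos
    · have h1 : ∀ z : ι → ℝ, auxE T (0 + 1) z = ∑ i ∈ T, z i := by
        intro z
        have := auxE_euler T z 0
        simpa [auxE_zero] using this
      simp [auxE_zero, h1, Finset.sum_add_distrib]
  | succ m ih =>
    intro T x y hx hy
    obtain ⟨hz0, hq⟩ := ih T x y (fun j hj => hx j (by omega)) (fun j hj => hy j (by omega))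
    have hz : auxG T (m + 1) (x + y) := by
      intro j hj
      rcases Nat.lt_or_ge j (m + 1) with h | h
      · exact hz0 j (by omega)
      · obtain rfl : j = m + 1 := by omega
        have h1 := div_pos (hx (m + 1) le_rfl) (hx m (by omega))
        have h2 := div_pos (hy (m + 1) le_rfl) (hy m (by omega))
        have h3 : 0 < auxE T (m + 1) (x + y) / auxE T m (x + y) := by linarith
        exact (div_pos_iff_of_pos_right (hz0 m le_rfl)).1 h3
    refine ⟨hz, ?_⟩
    have form : ∀ z : ι → ℝ, ((m : ℝ) + 2) * (auxE T (m + 1 + 1) z / auxE T (m + 1) z)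
        = ∑ i ∈ T, z i * auxE (T.erase i) (m + 1) z / auxE T (m + 1) z := by
      intro z
      rw [← Finset.sum_div, ← auxE_euler]
      push_cast
      ring
    have hm : (0 : ℝ) < (m : ℝ) + 2 := by positivity
    refine le_of_mul_le_mul_left ?_ hm
    rw [mul_add, form, form, form, ← Finset.sum_add_distrib]
    refine Finset.sum_le_sum fun i hi => ?_
    have gx := auxG_erase hi m x hx
    have gy := auxG_erase hi m y hy
    obtain ⟨gz, hiq⟩ := ih (T.erase i) x y gx gy
    have px := hx (m + 1) le_rfl
    have py := hy (m + 1) le_rfl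
    have pz := hz (m + 1) le_rfl
    rw [auxE_erase hi] at px py pz ⊢
    rw [auxE_erase hi m y, auxE_erase hi m (x + y)]
    exact aux_term (gx m le_rfl) (gy m le_rfl) (gz m le_rfl) px py pz hiq

theorem auxG_add {ι : Type*} [DecidableEq ι] {m : ℕ} {T : Finset ι} {x y : ι → ℝ}
    (hx : auxG T m x) (hy : auxG T m y) : auxG T m (x + y) := (aux_main m T x y hx hy).1

theorem aux_prod_ratio {ι : Type*} {k : ℕ} {T : Finset ι} {x : ι → ℝ} (hx : auxG T k x) :
    ∏ j ∈ Finset.range k, auxE T (j + 1) x / auxE T j x = auxE T k x := by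
  induction k with
  | zero => simp [auxE_zero]
  | succ k ih =>
    rw [Finset.prod_range_succ, ih fun j hj => hx j (by omega)]
    have := (hx k (by omega)).ne'
    field_simp

theorem aux_mink {k : ℕ} (hk : 1 ≤ k) (a b c : ℕ → ℝ) (ha : ∀ j < k, 0 < a j)
    (hb : ∀ j < k, 0 < b j) (hc : ∀ j < k, a j + b j ≤ c j) :
    (∏ j ∈ Finset.range k, a j) ^ ((1 : ℝ) / k) + (∏ j ∈ Finset.range k, b j) ^ ((1 : ℝ) / k)
      ≤ (∏ j ∈ Finset.range k, c j) ^ ((1 : ℝ) / k) := by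
  have hk0 : (0 : ℝ) < k := by exact_mod_cast hk
  have pc : ∀ j < k, 0 < c j := fun j hj => by linarith [ha j hj, hb j hj, hc j hj]
  have amgm : ∀ d : ℕ → ℝ, (∀ j < k, 0 < d j) →
      (∏ j ∈ Finset.range k, d j) ^ ((1 : ℝ) / k)
        ≤ (∑ j ∈ Finset.range k, (1 : ℝ) / k * (d j / c j))
          * (∏ j ∈ Finset.range k, c j) ^ ((1 : ℝ) / k) := by
    intro d hd
    have h := Real.geom_mean_le_arith_mean_weighted (Finset.range k) (fun _ => (1 : ℝ) / k)
      (fun j => d j / c j) (fun _ _ => by positivity) (by simp [hk0.ne'])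
      (fun j hj => (div_pos (hd j (Finset.mem_range.1 hj)) (pc j (Finset.mem_range.1 hj))).le)
    have hP : 0 < ∏ j ∈ Finset.range k, c j :=
      Finset.prod_pos fun j hj => pc j (Finset.mem_range.1 hj)
    have hD : 0 < ∏ j ∈ Finset.range k, d j :=
      Finset.prod_pos fun j hj => hd j (Finset.mem_range.1 hj)
    rw [Real.finsetProd_rpow _ _ (fun j hj =>
      (div_pos (hd j (Finset.mem_range.1 hj)) (pc j (Finset.mem_range.1 hj))).le),
      Finset.prod_div_distrib, Real.div_rpow hD.le hP.le,
      div_le_iff₀ (Real.rpow_pos_of_pos hP _)] at h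
    exact h
  have h1 := amgm a ha
  have h2 := amgm b hb
  have hP : 0 < ∏ j ∈ Finset.range k, c j :=
    Finset.prod_pos fun j hj => pc j (Finset.mem_range.1 hj)
  have hs : (∑ j ∈ Finset.range k, (1 : ℝ) / k * (a j / c j))
      + (∑ j ∈ Finset.range k, (1 : ℝ) / k * (b j / c j)) ≤ 1 := by
    rw [← Finset.sum_add_distrib]
    calc _ ≤ ∑ j ∈ Finset.range k, (1 : ℝ) / k := by
          refine Finset.sum_le_sum fun j hj => ?_
          have hj' := Finset.mem_range.1 hj
          rw [← mul_add, ← add_div]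
          refine mul_le_of_le_one_right (by positivity) ?_
          rw [div_le_one (pc j hj')]
          exact hc j hj'
      _ = 1 := by simp [hk0.ne']
  have hP' := Real.rpow_pos_of_pos hP ((1 : ℝ) / k)
  nlinarith [mul_le_mul_of_nonneg_right hs hP'.le]

theorem auxE_superadd {ι : Type*} [DecidableEq ι] {k : ℕ} (hk : 1 ≤ k) {T : Finset ι}
    {x y : ι → ℝ} (hx : auxG T k x) (hy : auxG T k y) :
    (auxE T k x) ^ ((1 : ℝ) / k) + (auxE T k y) ^ ((1 : ℝ) / k)
      ≤ (auxE T k (x + y)) ^ ((1 : ℝ) / k) := by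
  rw [← aux_prod_ratio hx, ← aux_prod_ratio hy, ← aux_prod_ratio (auxG_add hx hy)]
  refine aux_mink hk _ _ _ (fun j hj => div_pos (hx _ (by omega)) (hx _ (by omega)))
    (fun j hj => div_pos (hy _ (by omega)) (hy _ (by omega))) (fun j hj => ?_)
  exact (aux_main j T x y (fun i hi => hx i (by omega)) (fun i hi => hy i (by omega))).2

theorem auxE_smul {ι : Type*} (T : Finset ι) (j : ℕ) (a : ℝ) (x : ι → ℝ) :
    auxE T j (a • x) = a ^ j * auxE T j x := by
  unfold auxE
  rw [Finset.mul_sum]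
  refine Finset.sum_congr rfl fun s hs => ?_
  simp [Finset.prod_mul_distrib, (Finset.mem_powersetCard.1 hs).2]

theorem auxG_smul {ι : Type*} {T : Finset ι} {m : ℕ} {a : ℝ} (ha : 0 < a) {x : ι → ℝ}
    (hx : auxG T m x) : auxG T m (a • x) := by
  intro j hj
  rw [auxE_smul]
  exact mul_pos (pow_pos ha j) (hx j hj)

theorem auxE_map {ι κ : Type*} (f : ι ↪ κ) (T : Finset ι) (j : ℕ) (x : κ → ℝ) :
    auxE (T.map f) j x = auxE T j (x ∘ f) := by
  simp [auxE, Finset.powersetCard_map]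

/-- Adjoin the value `α`. -/
def auxAdj {n : ℕ} (α : ℝ) (lam : Fin n → ℝ) : Option (Fin n) → ℝ := fun o => o.elim α lam

/-- The full index set of `Option (Fin n)`. -/
def auxT (n : ℕ) : Finset (Option (Fin n)) :=
  insert none (Finset.univ.map Function.Embedding.some)

theorem auxE_adj {n : ℕ} (α : ℝ) (lam : Fin n → ℝ) (j : ℕ) :
    auxE (auxT n) (j + 1) (auxAdj α lam)
      = auxE Finset.univ (j + 1) lam + α * auxE Finset.univ j lam := by
  unfold auxT
  rw [auxE_insert (by simp), auxE_map, auxE_map]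
  rfl

theorem aux_esymmR {n : ℕ} (j : ℕ) (lam : Fin n → ℝ) :
    esymmR (j : ℤ) lam = auxE Finset.univ j lam := by
  simp [esymmR, sigmaOn, auxE]

theorem aux_Sfun {n k : ℕ} (hk : 1 ≤ k) (α : ℝ) (lam : Fin n → ℝ) :
    Sfun α (k : ℤ) lam = auxE (auxT n) k (auxAdj α lam) := by
  obtain ⟨j, rfl⟩ := Nat.exists_eq_add_of_le' hk
  rw [auxE_adj, Sfun, aux_esymmR]
  have : ((j + 1 : ℕ) : ℤ) - 1 = (j : ℤ) := by push_cast; ring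
  rw [this, aux_esymmR]

theorem aux_GammaCone {n k : ℕ} (lam : Fin n → ℝ) :
    lam ∈ GammaCone n k ↔ auxG Finset.univ k lam := by
  constructor
  · intro h j hj
    cases j with
    | zero => rw [auxE_zero]; exact one_pos
    | succ j => rw [← aux_esymmR]; exact h _ (by omega) hj
  · intro h i _ hi
    rw [aux_esymmR]; exact h i hi

theorem aux_GammaTilde {n k : ℕ} (hk : 1 ≤ k) {α : ℝ} (hα : 0 < α) (lam : Fin n → ℝ) :
    lam ∈ GammaTilde n k α ↔
      auxG Finset.univ (k - 1) lam ∧ auxG (auxT n) k (auxAdj α lam) := by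
  unfold GammaTilde
  rw [Set.mem_inter_iff, aux_GammaCone, Set.mem_setOf_eq, aux_Sfun hk]
  refine and_congr_right fun h => ⟨fun hS j hj => ?_, fun hG => hG k le_rfl⟩
  rcases Nat.lt_or_ge j k with hjk | hjk
  · cases j with
    | zero => rw [auxE_zero]; exact one_pos
    | succ j =>
      rw [auxE_adj]
      have h1 := h (j + 1) (by omega)
      have h2 := h j (by omega)
      positivity
  · obtain rfl : j = k := by omega
    exact hS

theorem aux_adj_comb {n : ℕ} (α : ℝ) (x y : Fin n → ℝ) {a b : ℝ} (hab : a + b = 1) :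
    auxAdj α (a • x + b • y) = a • auxAdj α x + b • auxAdj α y := by
  funext o
  cases o with
  | none => simp [auxAdj, ← add_mul, hab]
  | some i => simp [auxAdj]

theorem auxE_smul_rpow {ι : Type*} {T : Finset ι} {k : ℕ} (hk : 1 ≤ k) {a : ℝ} (ha : 0 < a)
    {x : ι → ℝ} (hx : auxG T k x) :
    (auxE T k (a • x)) ^ ((1 : ℝ) / k) = a * (auxE T k x) ^ ((1 : ℝ) / k) := by
  rw [auxE_smul, Real.mul_rpow (by positivity) (hx k le_rfl).le, one_div,
    Real.pow_rpow_inv_natCast ha.le (by omega)]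

/-- **Concavity of `S_k^{1/k}`** (Lemma 2.3 (d), first part): the function
`λ ↦ (σ_k(λ) + α σ_{k-1}(λ))^{1/k}` is concave on the convex cone `Γ̃_k`. -/
theorem Sk_rpow_concave
    {n k : ℕ} (hk : 1 ≤ k) (hkn : k ≤ n) (α : ℝ) (hα : 0 < α) :
    ConcaveOn ℝ (GammaTilde n k α)
      (fun lam => (Sfun α (k : ℤ) lam) ^ ((1 : ℝ) / (k : ℝ))) := by
  rw [concaveOn_iff_forall_pos]
  refine ⟨?_, ?_⟩
  · rw [convex_iff_forall_pos]
    intro x hx y hy a b ha hb hab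
    rw [aux_GammaTilde hk hα] at hx hy ⊢
    rw [aux_adj_comb α x y hab]
    exact ⟨auxG_add (auxG_smul ha hx.1) (auxG_smul hb hy.1),
      auxG_add (auxG_smul ha hx.2) (auxG_smul hb hy.2)⟩
  · intro x hx y hy a b ha hb hab
    rw [aux_GammaTilde hk hα] at hx hy
    simp only [smul_eq_mul]
    rw [aux_Sfun hk, aux_Sfun hk, aux_Sfun hk, aux_adj_comb α x y hab,
      ← auxE_smul_rpow hk ha hx.2, ← auxE_smul_rpow hk hb hy.2]
    exact auxE_superadd hk (auxG_smul ha hx.2) (auxG_smul hb hy.2)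
end
end

section
/- Let 1 ≤ l < k ≤ n and α > 0. On the convex cone Γ̃_k one has S_l(λ) = σ_l(λ) + α σ_{l−1}(λ) > 0, and the function λ ↦ (S_k(λ)/S_l(λ))^{1/(k−l)} is concave on Γ̃_k. -/
open scoped BigOperators

noncomputable section

/-! ### Newton's inequality -/

open Polynomial in
lemma aux_laguerre_s10 (m : Multiset ℝ) :
    2 * ((m.map (fun a => (X + C a : ℝ[X]))).prod.coeff 0 *
      (m.map (fun a => (X + C a : ℝ[X]))).prod.coeff 2) ≤
      ((m.map (fun a => (X + C a : ℝ[X]))).prod.coeff 1) ^ 2 := by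
  induction m using Multiset.induction_on with
  | empty => simp [coeff_one]
  | cons a m ih =>
    rw [Multiset.map_cons, Multiset.prod_cons]
    set q := (m.map (fun a => (X + C a : ℝ[X]))).prod
    have h0 : ((X + C a) * q).coeff 0 = a * q.coeff 0 := by simp [add_mul]
    have h1 : ((X + C a) * q).coeff 1 = q.coeff 0 + a * q.coeff 1 := by
      simp [add_mul, coeff_X_mul q 0]
    have h2 : ((X + C a) * q).coeff 2 = q.coeff 1 + a * q.coeff 2 := by
      simp [add_mul, coeff_X_mul q 1]
    rw [h0, h1, h2]
    nlinarith [sq_nonneg (q.coeff 0), mul_le_mul_of_nonneg_left ih (sq_nonneg a)]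

open Polynomial in
lemma aux_splits_derivative_s10 (p : ℝ[X]) (hp : p.Splits) : (derivative p).Splits := by
  by_cases h : p.natDegree = 0
  · apply Splits.of_natDegree_eq_zero
    have := natDegree_derivative_le p
    omega
  · rw [splits_iff_card_roots] at hp ⊢
    have h1 := card_roots_le_derivative p
    have h2 := natDegree_derivative_le p
    have h3 := card_roots' (derivative p)
    omega

open Polynomial in
lemma aux_newton_poly_s10 (m : ℕ) : ∀ (p : ℝ[X]), p.Splits →
    ((m : ℝ) + 2) * (p.coeff m * p.coeff (m + 2)) ≤ ((m : ℝ) + 1) * (p.coeff (m + 1)) ^ 2 := by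
  induction m with
  | zero =>
    intro p hp
    obtain ⟨s, hs⟩ := splits_iff_exists_multiset'.1 hp
    have h := aux_laguerre_s10 s
    set q := (s.map (fun a => (X + C a : ℝ[X]))).prod
    rw [hs]
    simp only [coeff_C_mul]
    have := mul_le_mul_of_nonneg_left h (sq_nonneg p.leadingCoeff)
    norm_num
    nlinarith
  | succ m ih =>
    intro p hp
    have h := ih _ (aux_splits_derivative_s10 p hp)
    simp only [coeff_derivative] at h
    push_cast at h ⊢
    have e1 : m + 2 + 1 = m + 1 + 2 := by ring
    rw [e1] at h
    have hpos : (0 : ℝ) < ((m : ℝ) + 1) * ((m : ℝ) + 2) := by positivity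
    refine le_of_mul_le_mul_left ?_ hpos
    nlinarith

/-- elementary symmetric functions with natural index -/
def eS {ι : Type*} (T : Finset ι) (j : ℕ) (x : ι → ℝ) : ℝ :=
  ∑ s ∈ T.powersetCard j, ∏ i ∈ s, x i

lemma eS_zero {ι : Type*} (T : Finset ι) (x : ι → ℝ) : eS T 0 x = 1 := by simp [eS]

lemma eS_gt {ι : Type*} (T : Finset ι) (j : ℕ) (x : ι → ℝ) (h : T.card < j) : eS T j x = 0 := by
  simp [eS, Finset.powersetCard_eq_empty.2 h]

open Polynomial in
lemma eS_newton {ι : Type*} (T : Finset ι) (j : ℕ) (x : ι → ℝ) :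
    eS T j x * eS T (j + 2) x ≤ eS T (j + 1) x ^ 2 := by
  by_cases hj : T.card < j + 2
  · rw [eS_gt T _ x hj]; nlinarith [sq_nonneg (eS T (j + 1) x)]
  push Not at hj
  obtain ⟨m, hm⟩ := Nat.exists_eq_add_of_le hj
  have hsp : (∏ i ∈ T, (X + C (x i) : ℝ[X])).Splits := Splits.prod fun i _ => Splits.X_add_C _
  have h := aux_newton_poly_s10 m _ hsp
  rw [Finset.prod_X_add_C_coeff _ _ (by omega), Finset.prod_X_add_C_coeff _ _ (by omega),
    Finset.prod_X_add_C_coeff _ _ (by omega)] at h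
  rw [show T.card - m = j + 2 by omega, show T.card - (m + 2) = j by omega,
    show T.card - (m + 1) = j + 1 by omega] at h
  change ((m : ℝ) + 2) * (eS T (j + 2) x * eS T j x) ≤ ((m : ℝ) + 1) * (eS T (j + 1) x) ^ 2 at h
  have hm : (0 : ℝ) ≤ m := Nat.cast_nonneg m
  by_contra hc
  push Not at hc
  nlinarith [sq_nonneg (eS T (j + 1) x)]

lemma eS_insert {ι : Type*} [DecidableEq ι] (T : Finset ι) (a : ι) (ha : a ∉ T) (j : ℕ)
    (x : ι → ℝ) : eS (insert a T) (j + 1) x = eS T (j + 1) x + x a * eS T j x := by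
  unfold eS
  rw [Finset.powersetCard_succ_insert ha, Finset.sum_union]
  · congr 1
    rw [Finset.sum_image, Finset.mul_sum]
    · refine Finset.sum_congr rfl fun s hs => ?_
      rw [Finset.prod_insert]
      exact fun h => ha ((Finset.mem_powersetCard.1 hs).1 h)
    · intro s hs t ht hst
      have h1 : a ∉ s := fun h => ha ((Finset.mem_powersetCard.1 hs).1 h)
      have h2 : a ∉ t := fun h => ha ((Finset.mem_powersetCard.1 ht).1 h)
      rw [← Finset.erase_insert h1, ← Finset.erase_insert h2]
      exact congrArg (fun u => u.erase a) hst
  · rw [Finset.disjoint_left]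
    intro s hs hs'
    obtain ⟨t, _, rfl⟩ := Finset.mem_image.1 hs'
    exact ha ((Finset.mem_powersetCard.1 hs).1 (Finset.mem_insert_self a t))

lemma eS_erase {ι : Type*} [DecidableEq ι] (T : Finset ι) (a : ι) (ha : a ∈ T) (j : ℕ)
    (x : ι → ℝ) : eS T (j + 1) x = eS (T.erase a) (j + 1) x + x a * eS (T.erase a) j x := by
  conv_lhs => rw [← Finset.insert_erase ha]
  exact eS_insert _ a (Finset.notMem_erase a T) j x

lemma eS_euler {ι : Type*} [DecidableEq ι] (T : Finset ι) : ∀ (j : ℕ) (x : ι → ℝ),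
    ((j : ℝ) + 1) * eS T (j + 1) x = ∑ i ∈ T, x i * eS (T.erase i) j x := by
  induction T using Finset.induction_on with
  | empty => intro j x; rw [eS_gt _ _ _ (by simp)]; simp
  | insert a T ha ih =>
    intro j x
    rw [Finset.sum_insert ha, Finset.erase_insert ha, eS_insert T a ha]
    have he : ∀ i ∈ T, (insert a T).erase i = insert a (T.erase i) := by
      intro i hi
      rw [Finset.erase_insert_of_ne]
      rintro rfl; exact ha hi
    cases j with
    | zero =>
      have := ih 0 x
      simp only [eS_zero] at this ⊢
      push_cast at this ⊢
      linarith
    | succ j =>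
      have h1 := ih (j + 1) x
      have h2 := ih j x
      have h3 : ∑ i ∈ T, x i * eS ((insert a T).erase i) (j + 1) x =
          ∑ i ∈ T, x i * eS (T.erase i) (j + 1) x + x a * ∑ i ∈ T, x i * eS (T.erase i) j x := by
        rw [Finset.mul_sum, ← Finset.sum_add_distrib]
        refine Finset.sum_congr rfl fun i hi => ?_
        rw [he i hi, eS_insert _ a (fun h => ha (Finset.mem_of_mem_erase h))]
        ring
      rw [h3, ← h1, ← h2]
      push_cast
      ring

lemma eS_smul {ι : Type*} (T : Finset ι) (j : ℕ) (c : ℝ) (x : ι → ℝ) :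
    eS T j (c • x) = c ^ j * eS T j x := by
  unfold eS
  rw [Finset.mul_sum]
  refine Finset.sum_congr rfl fun s hs => ?_
  simp only [Pi.smul_apply, smul_eq_mul]
  rw [Finset.prod_mul_distrib, Finset.prod_const, (Finset.mem_powersetCard.1 hs).2]

/-- Garding cone on a finset. -/
def GC {ι : Type*} (T : Finset ι) (k : ℕ) (x : ι → ℝ) : Prop := ∀ j, j ≤ k → 0 < eS T j x

lemma GC.mono {ι : Type*} {T : Finset ι} {k l : ℕ} {x : ι → ℝ} (h : GC T k x) (hl : l ≤ k) :
    GC T l x := fun j hj => h j (hj.trans hl)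

lemma GC.erase {ι : Type*} [DecidableEq ι] {T : Finset ι} {x : ι → ℝ} {a : ι} (ha : a ∈ T) :
    ∀ {k : ℕ}, GC T (k + 1) x → GC (T.erase a) k x := by
  intro k
  induction k with
  | zero => intro _ j hj; rw [Nat.le_zero.1 hj, eS_zero]; exact one_pos
  | succ k ih =>
    intro h j hj
    have h' := ih (h.mono (Nat.le_succ _))
    rcases Nat.lt_or_ge j (k + 1) with hlt | hge
    · exact h' j (by omega)
    obtain rfl : j = k + 1 := by omega
    have hA := h' k le_rfl
    have h1 := h (k + 1) (by omega)
    have h2 := h (k + 2) (by omega)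
    have hN := eS_newton (T.erase a) k x
    rw [eS_erase T a ha] at h1 h2
    by_contra hc
    push Not at hc
    set A := eS (T.erase a) k x
    set B := eS (T.erase a) (k + 1) x
    set D := eS (T.erase a) (k + 2) x
    set t := x a
    -- `0 < B + t A`, `0 < D + t B`, `A D ≤ B ^ 2`
    have h3 := mul_pos hA h2
    nlinarith [mul_nonneg h1.le (neg_nonneg.2 hc)]

lemma aux_frac {a b P Q R : ℝ} (h1 : 0 < a + P) (h2 : 0 < b + Q) (hR : P + Q ≤ R) :
    a * P / (a + P) + b * Q / (b + Q) ≤ (a + b) * R / (a + b + R) := by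
  have h3 : 0 < a + b + (P + Q) := by linarith
  have h4 : 0 < a + b + R := by linarith
  have step1 : (a + b) * (P + Q) / (a + b + (P + Q)) ≤ (a + b) * R / (a + b + R) := by
    rw [div_le_div_iff₀ h3 h4]
    nlinarith [mul_nonneg (sq_nonneg (a + b)) (sub_nonneg.2 hR)]
  refine le_trans ?_ step1
  rw [div_add_div _ _ h1.ne' h2.ne', div_le_div_iff₀ (mul_pos h1 h2) h3]
  nlinarith [sq_nonneg (a * Q - b * P)]

lemma GC.superadd {ι : Type*} [DecidableEq ι] {x y : ι → ℝ} : ∀ (k : ℕ) (T : Finset ι),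
    GC T (k + 1) x → GC T (k + 1) y →
    GC T (k + 1) (x + y) ∧ eS T (k + 1) x / eS T k x + eS T (k + 1) y / eS T k y ≤
      eS T (k + 1) (x + y) / eS T k (x + y) := by
  intro k
  induction k with
  | zero =>
    intro T hx hy
    have he : eS T 1 (x + y) = eS T 1 x + eS T 1 y := by
      have h1 := eS_euler T 0 x
      have h2 := eS_euler T 0 y
      have h3 := eS_euler T 0 (x + y)
      simp only [eS_zero, Nat.cast_zero, zero_add, one_mul, mul_one, Pi.add_apply,
        Finset.sum_add_distrib] at h1 h2 h3
      rw [h1, h2, h3]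
    have h1 := hx 1 le_rfl
    have h2 := hy 1 le_rfl
    refine ⟨?_, ?_⟩
    · intro j hj
      rcases Nat.lt_or_ge j 1 with h | h
      · obtain rfl : j = 0 := by omega
        rw [eS_zero]; exact one_pos
      · obtain rfl : j = 1 := by omega
        rw [he]; linarith
    · simp only [eS_zero, zero_add, div_one, he, le_refl]
  | succ k ih =>
    intro T hx hy
    obtain ⟨hxy, -⟩ := ih T (hx.mono (Nat.le_succ _)) (hy.mono (Nat.le_succ _))
    have key : ∀ z : ι → ℝ, GC T (k + 1) z → (∀ i ∈ T, GC (T.erase i) (k + 1) z) →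
        ((k : ℝ) + 2) * (eS T (k + 2) z / eS T (k + 1) z) =
          ∑ i ∈ T, z i * (eS (T.erase i) (k + 1) z / eS (T.erase i) k z) /
            (z i + eS (T.erase i) (k + 1) z / eS (T.erase i) k z) := by
      intro z hz hzi
      have h1 := eS_euler T (k + 1) z
      push_cast at h1
      rw [show (k : ℝ) + 2 = (k : ℝ) + 1 + 1 by ring, ← mul_div_assoc, h1, Finset.sum_div]
      refine Finset.sum_congr rfl fun i hi => ?_
      have hA := hzi i hi k (by omega)
      have hT := hz (k + 1) le_rfl
      have hs := eS_erase T i hi k z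
      have e : z i + eS (T.erase i) (k + 1) z / eS (T.erase i) k z =
          eS T (k + 1) z / eS (T.erase i) k z := by
        rw [hs]; field_simp; ring
      rw [e]
      field_simp
    have hxi : ∀ i ∈ T, GC (T.erase i) (k + 1) x := fun i hi => GC.erase hi hx
    have hyi : ∀ i ∈ T, GC (T.erase i) (k + 1) y := fun i hi => GC.erase hi hy
    have hxyi : ∀ i ∈ T, GC (T.erase i) (k + 1) (x + y) :=
      fun i hi => (ih _ (hxi i hi) (hyi i hi)).1
    have kx := key x (hx.mono (Nat.le_succ _)) hxi
    have ky := key y (hy.mono (Nat.le_succ _)) hyi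
    have kxy := key (x + y) hxy hxyi
    have hpos : ∀ z : ι → ℝ, GC T (k + 1) z → (∀ i ∈ T, GC (T.erase i) (k + 1) z) →
        ∀ i ∈ T, 0 < z i + eS (T.erase i) (k + 1) z / eS (T.erase i) k z := by
      intro z hz hzi i hi
      have hA := hzi i hi k (by omega)
      have hT := hz (k + 1) le_rfl
      have hs := eS_erase T i hi k z
      have e : z i + eS (T.erase i) (k + 1) z / eS (T.erase i) k z =
          eS T (k + 1) z / eS (T.erase i) k z := by
        rw [hs]; field_simp; ring
      rw [e]; positivity
    have main : eS T (k + 2) x / eS T (k + 1) x + eS T (k + 2) y / eS T (k + 1) y ≤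
        eS T (k + 2) (x + y) / eS T (k + 1) (x + y) := by
      have hk : (0 : ℝ) < (k : ℝ) + 2 := by positivity
      refine le_of_mul_le_mul_left ?_ hk
      rw [mul_add, kx, ky, kxy, ← Finset.sum_add_distrib]
      refine Finset.sum_le_sum fun i hi => ?_
      exact aux_frac (hpos x (hx.mono (Nat.le_succ _)) hxi i hi)
        (hpos y (hy.mono (Nat.le_succ _)) hyi i hi) (ih _ (hxi i hi) (hyi i hi)).2
    refine ⟨?_, main⟩
    intro j hj
    rcases Nat.lt_or_ge j (k + 2) with h | h
    · exact hxy j (by omega)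
    · obtain rfl : j = k + 2 := by omega
      have h1 : 0 < eS T (k + 2) x / eS T (k + 1) x := div_pos (hx _ le_rfl) (hx _ (by omega))
      have h2 : 0 < eS T (k + 2) y / eS T (k + 1) y := div_pos (hy _ le_rfl) (hy _ (by omega))
      have h3 := hxy (k + 1) le_rfl
      have h4 := lt_of_lt_of_le (add_pos h1 h2) main
      exact (div_pos_iff_of_pos_right h3).1 h4

lemma GC.smul {ι : Type*} {T : Finset ι} {k : ℕ} {x : ι → ℝ} (h : GC T k x) {c : ℝ}
    (hc : 0 < c) : GC T k (c • x) := by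
  intro j hj
  rw [eS_smul]
  exact mul_pos (pow_pos hc _) (h j hj)

lemma eS_ratio (l m : ℕ) {ι : Type*} {T : Finset ι} {x : ι → ℝ} (h : GC T (l + m) x) :
    ∏ i ∈ Finset.range m, (eS T (l + i + 1) x / eS T (l + i) x) = eS T (l + m) x / eS T l x := by
  induction m with
  | zero => simp [(h l le_rfl).ne']
  | succ m ih =>
    rw [Finset.prod_range_succ, ih (h.mono (by omega))]
    have h1 := (h l (by omega)).ne'
    have h2 := (h (l + m) (by omega)).ne'
    rw [← add_assoc]
    field_simp

lemma aux_geom (m : ℕ) (hm : 0 < m) (a b c : ℕ → ℝ) (ha : ∀ i < m, 0 < a i)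
    (hb : ∀ i < m, 0 < b i) (hc : ∀ i < m, a i + b i ≤ c i) :
    (∏ i ∈ Finset.range m, a i) ^ ((1 : ℝ) / m) + (∏ i ∈ Finset.range m, b i) ^ ((1 : ℝ) / m) ≤
      (∏ i ∈ Finset.range m, c i) ^ ((1 : ℝ) / m) := by
  have hcp : ∀ i < m, 0 < c i := fun i hi => by linarith [ha i hi, hb i hi, hc i hi]
  have hm' : (0 : ℝ) < m := by exact_mod_cast hm
  have hC : 0 < (∏ i ∈ Finset.range m, c i) ^ ((1 : ℝ) / m) :=
    Real.rpow_pos_of_pos (Finset.prod_pos fun i hi => hcp i (Finset.mem_range.1 hi)) _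
  have amgm : ∀ d : ℕ → ℝ, (∀ i < m, 0 < d i) →
      (∏ i ∈ Finset.range m, d i) ^ ((1 : ℝ) / m) / (∏ i ∈ Finset.range m, c i) ^ ((1 : ℝ) / m) ≤
        ∑ i ∈ Finset.range m, (1 : ℝ) / m * (d i / c i) := by
    intro d hd
    have h := Real.geom_mean_le_arith_mean_weighted (Finset.range m) (fun _ => (1 : ℝ) / m)
      (fun i => d i / c i) (fun i _ => by positivity) (by simp; field_simp)
      (fun i hi => (div_pos (hd i (Finset.mem_range.1 hi)) (hcp i (Finset.mem_range.1 hi))).le)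
    refine le_trans (le_of_eq ?_) h
    rw [Real.finsetProd_rpow _ _ fun i hi =>
      (div_pos (hd i (Finset.mem_range.1 hi)) (hcp i (Finset.mem_range.1 hi))).le,
      Finset.prod_div_distrib, Real.div_rpow]
    · exact Finset.prod_nonneg fun i hi => (hd i (Finset.mem_range.1 hi)).le
    · exact Finset.prod_nonneg fun i hi => (hcp i (Finset.mem_range.1 hi)).le
  have hsum := add_le_add (amgm a ha) (amgm b hb)
  rw [← Finset.sum_add_distrib, ← add_div] at hsum
  have hle : ∑ i ∈ Finset.range m, ((1 : ℝ) / m * (a i / c i) + (1 : ℝ) / m * (b i / c i)) ≤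
      ∑ i ∈ Finset.range m, (1 : ℝ) / m := by
    refine Finset.sum_le_sum fun i hi => ?_
    have hi' := Finset.mem_range.1 hi
    rw [← mul_add, ← add_div]
    refine mul_le_of_le_one_right (by positivity) ?_
    rw [div_le_one (hcp i hi')]
    exact hc i hi'
  have h1 : ∑ i ∈ Finset.range m, (1 : ℝ) / m = 1 := by simp; field_simp
  rw [h1] at hle
  exact (div_le_one hC).1 (hsum.trans hle)

lemma GC.concave {ι : Type*} [DecidableEq ι] {T : Finset ι} {x y : ι → ℝ} (l m : ℕ) (hm : 0 < m)
    (hx : GC T (l + m) x) (hy : GC T (l + m) y) {s t : ℝ} (hs : 0 < s) (ht : 0 < t) :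
    GC T (l + m) (s • x + t • y) ∧
    s * (eS T (l + m) x / eS T l x) ^ ((1 : ℝ) / m) +
      t * (eS T (l + m) y / eS T l y) ^ ((1 : ℝ) / m) ≤
      (eS T (l + m) (s • x + t • y) / eS T l (s • x + t • y)) ^ ((1 : ℝ) / m) := by
  have hsx := hx.smul hs
  have hty := hy.smul ht
  have hm' : (m : ℝ) ≠ 0 := by exact_mod_cast hm.ne'
  have hz : GC T (l + m) (s • x + t • y) := by
    obtain ⟨r, hr⟩ : ∃ r, l + m = r + 1 := ⟨l + m - 1, by omega⟩
    rw [hr] at hsx hty ⊢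
    exact (GC.superadd r T hsx hty).1
  have hom : ∀ (c : ℝ) (z : ι → ℝ), 0 < c → GC T (l + m) z →
      c * (eS T (l + m) z / eS T l z) ^ ((1 : ℝ) / m) =
        (eS T (l + m) (c • z) / eS T l (c • z)) ^ ((1 : ℝ) / m) := by
    intro c z hc hzz
    have h1 := hzz l (by omega)
    have h2 := hzz (l + m) le_rfl
    have e : eS T (l + m) (c • z) / eS T l (c • z) = c ^ m * (eS T (l + m) z / eS T l z) := by
      rw [eS_smul, eS_smul, pow_add]
      have := (pow_pos hc l).ne'
      field_simp
    rw [e, Real.mul_rpow (by positivity) (by positivity), ← Real.rpow_natCast c m,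
      ← Real.rpow_mul hc.le, mul_one_div_cancel hm', Real.rpow_one]
  refine ⟨hz, ?_⟩
  rw [hom s x hs hx, hom t y ht hy, ← eS_ratio l m hsx, ← eS_ratio l m hty, ← eS_ratio l m hz]
  refine aux_geom m hm _ _ _ ?_ ?_ ?_
  · intro i hi
    exact div_pos (hsx _ (by omega)) (hsx _ (by omega))
  · intro i hi
    exact div_pos (hty _ (by omega)) (hty _ (by omega))
  · intro i hi
    exact (GC.superadd (l + i) T (hsx.mono (by omega)) (hty.mono (by omega))).2

/-! ### Adding the extra variable `α` -/

/-- the vector `(λ, α)` -/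
def extV {n : ℕ} (α : ℝ) (lam : Fin n → ℝ) : Option (Fin n) → ℝ := fun o => o.elim α lam

/-- the old indices -/
def oldT (n : ℕ) : Finset (Option (Fin n)) := Finset.univ.map Function.Embedding.some

lemma none_oldT (n : ℕ) : none ∉ oldT n := by simp [oldT]

lemma eS_old {n : ℕ} (α : ℝ) (j : ℕ) (lam : Fin n → ℝ) :
    eS (oldT n) j (extV α lam) = esymmR (j : ℤ) lam := by
  unfold eS oldT esymmR sigmaOn
  rw [if_pos (Int.natCast_nonneg j), Finset.powersetCard_map, Finset.sum_map, Int.toNat_natCast]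
  refine Finset.sum_congr rfl fun s _ => ?_
  simp [extV]

lemma eS_ext {n : ℕ} (α : ℝ) (j : ℕ) (lam : Fin n → ℝ) :
    eS (insert none (oldT n)) (j + 1) (extV α lam) = Sfun α ((j + 1 : ℕ) : ℤ) lam := by
  rw [eS_insert _ _ (none_oldT n), eS_old, eS_old]
  unfold Sfun
  rw [show ((j + 1 : ℕ) : ℤ) - 1 = (j : ℤ) by push_cast; ring]
  rfl

lemma mem_tilde_iff {n k : ℕ} (hk : 1 ≤ k) {α : ℝ} (hα : 0 < α) (lam : Fin n → ℝ) :
    lam ∈ GammaTilde n k α ↔ GC (insert none (oldT n)) k (extV α lam) := by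
  obtain ⟨r, rfl⟩ : ∃ r, k = r + 1 := ⟨k - 1, by omega⟩
  constructor
  · rintro ⟨h1, h2⟩
    have h2' : 0 < Sfun α ((r + 1 : ℕ) : ℤ) lam := h2
    have h1' : ∀ i, i ≤ r → 0 < eS (oldT n) i (extV α lam) := by
      intro i hi
      rcases Nat.eq_zero_or_pos i with rfl | h0
      · rw [eS_zero]; exact one_pos
      · rw [eS_old]; exact h1 i h0 (by simpa using hi)
    intro j hj
    cases j with
    | zero => rw [eS_zero]; exact one_pos
    | succ j =>
      rcases Nat.lt_or_ge j r with h | h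
      · rw [eS_insert _ _ (none_oldT n)]
        exact add_pos (h1' _ (by omega)) (mul_pos hα (h1' _ (by omega)))
      · obtain rfl : j = r := by omega
        rw [eS_ext]; exact h2'
  · intro h
    refine ⟨?_, ?_⟩
    · have := GC.erase (Finset.mem_insert_self none (oldT n)) h
      rw [Finset.erase_insert (none_oldT n)] at this
      intro i _ hi
      rw [← eS_old α]
      exact this i (by simpa using hi)
    · have := h (r + 1) le_rfl
      rw [eS_ext] at this
      exact this

lemma extV_comb {n : ℕ} (α : ℝ) (x y : Fin n → ℝ) {s t : ℝ} (hst : s + t = 1) :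
    s • extV α x + t • extV α y = extV α (s • x + t • y) := by
  funext o
  cases o with
  | none => simp [extV, ← add_mul, hst]
  | some i => simp [extV]

/-- **Positivity of `S_l` and concavity of quotients** (Lemma 2.3 (d), second part):
for `1 ≤ l < k ≤ n`, on `Γ̃_k` one has `S_l(λ) > 0`, and
`λ ↦ (S_k(λ)/S_l(λ))^{1/(k-l)}` is concave on `Γ̃_k`. -/
theorem Sk_quotient_rpow_concave
    {n k l : ℕ} (hl : 1 ≤ l) (hlk : l < k) (hkn : k ≤ n) (α : ℝ) (hα : 0 < α) :
    (∀ lam ∈ GammaTilde n k α, 0 < Sfun α (l : ℤ) lam) ∧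
    ConcaveOn ℝ (GammaTilde n k α)
      (fun lam => (Sfun α (k : ℤ) lam / Sfun α (l : ℤ) lam)
        ^ ((1 : ℝ) / ((k : ℝ) - (l : ℝ)))) := by
  have hk1 : 1 ≤ k := by omega
  obtain ⟨p, rfl⟩ : ∃ p, l = p + 1 := ⟨l - 1, by omega⟩
  obtain ⟨m, rfl⟩ : ∃ m, k = p + 1 + m := ⟨k - (p + 1), by omega⟩
  have hm : 0 < m := by omega
  have eK : ∀ z : Fin n → ℝ, Sfun α ((p + 1 + m : ℕ) : ℤ) z =
      eS (insert none (oldT n)) (p + 1 + m) (extV α z) := by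
    intro z
    rw [show p + 1 + m = (p + m) + 1 by ring, eS_ext]
  have eL : ∀ z : Fin n → ℝ, Sfun α ((p + 1 : ℕ) : ℤ) z =
      eS (insert none (oldT n)) (p + 1) (extV α z) := fun z => (eS_ext α p z).symm
  refine ⟨?_, ?_⟩
  · intro lam h
    rw [mem_tilde_iff hk1 hα] at h
    rw [eL]
    exact h _ (by omega)
  · have hmm : (((p + 1 + m : ℕ) : ℝ) - ((p + 1 : ℕ) : ℝ)) = (m : ℝ) := by push_cast; ring
    rw [concaveOn_iff_forall_pos]
    refine ⟨?_, ?_⟩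
    · rw [convex_iff_forall_pos]
      intro x hx y hy s t hs ht hst
      rw [mem_tilde_iff hk1 hα] at hx hy ⊢
      rw [← extV_comb α x y hst]
      exact (GC.concave (p + 1) m hm hx hy hs ht).1
    · intro x hx y hy s t hs ht hst
      rw [mem_tilde_iff hk1 hα] at hx hy
      have := (GC.concave (p + 1) m hm hx hy hs ht).2
      rw [extV_comb α x y hst] at this
      simp only [eK, eL, hmm, smul_eq_mul]
      exact this
end
end
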